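/- In the single-database problem with no side information (Z constant), the auxiliary variable in Γ(D) may be taken to be the reconstruction itself: Γ(D) = sup H(X_h | X̂), the supremum over all conditional pmfs p(x̂ | x_r, x_h) on the finite alphabet 𝒳̂ satisfying E[d(X_r, X̂)] ≤ D. -/

import Mathlib

open scoped BigOperators
open Classical

noncomputable section

/-- A probability mass function on a finite type: a nonnegative function summing to 1. -/
def IsPMF {α : Type} [Fintype α] (q : α → ℝ) : Prop :=
  (∀ a, 0 ≤ q a) ∧ ∑ a, q a = 1

/-- A conditional pmf (channel) from `α` to `β`. -/
def IsKernel {α β : Type} [Fintype β] (k : α → β → ℝ) : Prop :=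
  ∀ a, (∀ b, 0 ≤ k a b) ∧ ∑ b, k a b = 1

/-- Pushforward distribution of a pmf `μ` along a map `f`. -/
def pushf {Ω α : Type} [Fintype Ω] (μ : Ω → ℝ) (f : Ω → α) : α → ℝ :=
  fun a => ∑ ω, if f ω = a then μ ω else 0

/-- Shannon entropy (base 2) of a pmf; the convention `0 · log 0 = 0` is automatic
since `Real.logb 2 0 = 0` in Mathlib. -/
def ent {α : Type} [Fintype α] (q : α → ℝ) : ℝ :=
  -∑ a, q a * Real.logb 2 (q a)

/-- Entropy of the random variable `f` under the pmf `μ`. -/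
def Hof {Ω α : Type} [Fintype Ω] [Fintype α] (μ : Ω → ℝ) (f : Ω → α) : ℝ :=
  ent (pushf μ f)

/-- Conditional Shannon entropy `H(f | g)` under `μ`. -/
def condH {Ω α β : Type} [Fintype Ω] [Fintype α] [Fintype β]
    (μ : Ω → ℝ) (f : Ω → α) (g : Ω → β) : ℝ :=
  Hof μ (fun ω => (f ω, g ω)) - Hof μ g

/-- Shannon mutual information `I(f ; g)` under `μ`. -/
def mutI {Ω α β : Type} [Fintype Ω] [Fintype α] [Fintype β]
    (μ : Ω → ℝ) (f : Ω → α) (g : Ω → β) : ℝ :=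
  Hof μ f + Hof μ g - Hof μ (fun ω => (f ω, g ω))

/-- Expectation of `h` under the pmf `μ`. -/
def expect {Ω : Type} [Fintype Ω] (μ : Ω → ℝ) (h : Ω → ℝ) : ℝ :=
  ∑ ω, μ ω * h ω

/-- The i.i.d. product pmf of `n` copies of `p`. -/
def iidPMF {α : Type} [Fintype α] (p : α → ℝ) (n : ℕ) : (Fin n → α) → ℝ :=
  fun x => ∏ i, p (x i)


/-- Joint pmf of `((X_r, X_h), U)` obtained from the source pmf `p` on `X_r × X_h` and a
conditional pmf `pu = p(u | x_r, x_h)` (no side information). -/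
def jointU0 {Xr Xh U : Type} (p : Xr × Xh → ℝ) (pu : Xr × Xh → U → ℝ) :
    (Xr × Xh) × U → ℝ :=
  fun su => p su.1 * pu su.1 su.2

section Pushforward

variable {Ω α β γ : Type} [Fintype Ω]

/-- Change of variables for a pushforward. -/
theorem sum_pushf_mul [Fintype α] (μ : Ω → ℝ) (f : Ω → α) (h : α → ℝ) :
    ∑ a, pushf μ f a * h a = ∑ ω, μ ω * h (f ω) := by
  simp only [pushf, Finset.sum_mul, ite_mul, zero_mul]
  rw [Finset.sum_comm]
  simp

theorem sum_pushf [Fintype α] (μ : Ω → ℝ) (f : Ω → α) : ∑ a, pushf μ f a = ∑ ω, μ ω := by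
  simpa using sum_pushf_mul μ f fun _ => 1

theorem pushf_pushf [Fintype α] (μ : Ω → ℝ) (f : Ω → α) (h : α → β) :
    pushf (pushf μ f) h = pushf μ fun ω => h (f ω) := by
  funext b
  simpa [pushf] using sum_pushf_mul μ f fun a => if h a = b then 1 else 0

theorem pushf_nonneg {μ : Ω → ℝ} (hμ : ∀ ω, 0 ≤ μ ω) (f : Ω → α) (a : α) :
    0 ≤ pushf μ f a :=
  Finset.sum_nonneg fun ω _ => by split_ifs <;> simp [hμ]

theorem le_pushf_apply {μ : Ω → ℝ} (hμ : ∀ ω, 0 ≤ μ ω) (f : Ω → α) (ω : Ω) :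
    μ ω ≤ pushf μ f (f ω) := by
  have h := Finset.single_le_sum (f := fun ω' => if f ω' = f ω then μ ω' else 0)
    (fun ω' _ => by split_ifs <;> simp [hμ]) (Finset.mem_univ ω)
  simpa [pushf] using h

/-- The first coordinate of a joint pushforward marginalizes out. -/
theorem sum_pushf_prodMk [Fintype α] (μ : Ω → ℝ) (f : Ω → α) (g : Ω → β) (b : β) :
    ∑ a, pushf μ (fun ω => (f ω, g ω)) (a, b) = pushf μ g b := by
  simp only [pushf, Prod.mk.injEq]
  rw [Finset.sum_comm]
  simp [ite_and]

theorem Hof_eq_sum [Fintype α] (μ : Ω → ℝ) (f : Ω → α) :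
    Hof μ f = -∑ ω, μ ω * Real.logb 2 (pushf μ f (f ω)) := by
  rw [Hof, ent, sum_pushf_mul μ f fun a => Real.logb 2 (pushf μ f a)]

theorem condH_pushf {Ω' : Type} [Fintype Ω'] [Fintype α] [Fintype β] (μ : Ω → ℝ)
    (π : Ω → Ω') (f : Ω' → α) (g : Ω' → β) :
    condH (pushf μ π) f g = condH μ (fun ω => f (π ω)) fun ω => g (π ω) := by
  simp only [condH, Hof, pushf_pushf]

theorem mul_log_ratio_le {m r R r' R' : ℝ} (hm : 0 ≤ m) (hr : m ≤ r) (hR : m ≤ R)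
    (hr' : m ≤ r') (hR' : m ≤ R') :
    m * (Real.log R - Real.log r + Real.log r' - Real.log R') ≤
      m * (R * r' / (r * R')) - m := by
  rcases hm.eq_or_lt with rfl | hm
  · simp
  have hr := hm.trans_le hr
  have hR := hm.trans_le hR
  have hr' := hm.trans_le hr'
  have hR' := hm.trans_le hR'
  have h := Real.log_le_sub_one_of_pos (x := R * r' / (r * R')) (by positivity)
  rw [Real.log_div (by positivity) (by positivity), Real.log_mul hR.ne' hr'.ne',
    Real.log_mul hr.ne' hR'.ne'] at h
  nlinarith

theorem sum_mul_ratio_le [Fintype α] [Fintype β] {μ : Ω → ℝ} (hμ : ∀ ω, 0 ≤ μ ω)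
    (f : Ω → α) (g : Ω → β)
    (k : β → γ) :
    ∑ ω, μ ω * (pushf μ g (g ω) * pushf μ (fun ω => (f ω, k (g ω))) (f ω, k (g ω)) /
      (pushf μ (fun ω => (f ω, g ω)) (f ω, g ω) * pushf μ (fun ω => k (g ω)) (k (g ω)))) ≤
      ∑ ω, μ ω := by
  rw [← sum_pushf_mul μ (fun ω => (f ω, g ω)) fun ab =>
    pushf μ g ab.2 * pushf μ (fun ω => (f ω, k (g ω))) (ab.1, k ab.2) /
      (pushf μ (fun ω => (f ω, g ω)) ab * pushf μ (fun ω => k (g ω)) (k ab.2)),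
    ← sum_pushf μ g, Fintype.sum_prod_type_right]
  refine Finset.sum_le_sum fun b _ => ?_
  have hR := pushf_nonneg hμ g b
  have hR' := pushf_nonneg hμ (fun ω => k (g ω)) (k b)
  calc
    _ ≤ ∑ a, pushf μ g b / pushf μ (fun ω => k (g ω)) (k b) *
        pushf μ (fun ω => (f ω, k (g ω))) (a, k b) := by
      refine Finset.sum_le_sum fun a _ => ?_
      have hr' := pushf_nonneg hμ (fun ω => (f ω, k (g ω))) (a, k b)
      rcases eq_or_ne (pushf μ (fun ω => (f ω, g ω)) (a, b)) 0 with h | h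
      · rw [h, zero_mul]
        positivity
      · rw [mul_div_assoc', mul_div_mul_left _ _ h, mul_div_right_comm]
    _ ≤ pushf μ g b := by
      rw [← Finset.mul_sum, sum_pushf_prodMk μ f (fun ω => k (g ω)), div_mul_eq_mul_div,
        mul_div_assoc]
      exact mul_le_of_le_one_right hR (div_self_le_one _)

/-- Coarsening the conditioning variable does not decrease conditional entropy. -/
theorem condH_le_condH_comp [Fintype α] [Fintype β] [Fintype γ] {μ : Ω → ℝ} (hμ : ∀ ω, 0 ≤ μ ω)
    (f : Ω → α) (g : Ω → β)
    (k : β → γ) :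
    condH μ f g ≤ condH μ f fun ω => k (g ω) := by
  have key := (Finset.sum_le_sum fun ω (_ : ω ∈ Finset.univ) =>
    mul_log_ratio_le (hμ ω) (le_pushf_apply hμ (fun ω => (f ω, g ω)) ω)
      (le_pushf_apply hμ g ω) (le_pushf_apply hμ (fun ω => (f ω, k (g ω))) ω)
      (le_pushf_apply hμ (fun ω => k (g ω)) ω))
  rw [Finset.sum_sub_distrib] at key
  have key := key.trans (sub_nonpos.2 (sum_mul_ratio_le hμ f g k))
  simp only [mul_sub, mul_add, Finset.sum_sub_distrib, Finset.sum_add_distrib] at key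
  have h2 : 0 < Real.log 2 := Real.log_pos one_lt_two
  simp only [condH, Hof_eq_sum, Real.logb, mul_div_assoc', ← Finset.sum_div]
  rw [← sub_nonneg]
  have := div_nonneg (neg_nonneg.2 key) h2.le
  refine this.trans_eq ?_
  ring

end Pushforward

/-- Post-processing the channel output by `g` pushes the joint pmf forward. -/
theorem jointU0_pushf {Xr Xh U V : Type} [Fintype Xr] [Fintype Xh] [Fintype U]
    (p : Xr × Xh → ℝ) (pu : Xr × Xh → U → ℝ) (g : U → V) :
    jointU0 p (fun x => pushf (pu x) g) =
      pushf (jointU0 p pu) fun su => (su.1, g su.2) := by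
  funext ⟨x, v⟩
  simp [jointU0, pushf, Fintype.sum_prod_type, Finset.mul_sum, ite_and,
    Finset.sum_ite_irrel]

theorem IsKernel.pushf {α U V : Type} [Fintype U] [Fintype V] {k : α → U → ℝ}
    (hk : IsKernel k) (g : U → V) : IsKernel fun x => pushf (k x) g :=
  fun x => ⟨pushf_nonneg (hk x).1 g, (sum_pushf _ _).trans (hk x).2⟩

/-- In the single-database problem with no side information, the auxiliary
variable in `Γ(D)` may be taken to be the reconstruction itself:
`Γ(D) = sup H(X_h | X̂)`, the sup over conditional pmfs `p(x̂ | x_r, x_h)` with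
`E[d(X_r, X̂)] ≤ D`. -/
theorem Gamma_eq_sup_over_reconstruction
    {Xr Xh Xhat : Type} [Fintype Xr] [Fintype Xh] [Fintype Xhat]
    (p : Xr × Xh → ℝ) (hp : IsPMF p)
    (d : Xr → Xhat → ℝ) (hd : ∀ a b, 0 ≤ d a b)
    (D : ℝ) (hD : 0 ≤ D) :
    sSup { e | ∃ (U : Type) (_ : Fintype U) (pu : Xr × Xh → U → ℝ) (g : U → Xhat),
        IsKernel pu ∧
        expect (jointU0 p pu) (fun su => d su.1.1 (g su.2)) ≤ D ∧
        e = condH (jointU0 p pu) (fun su => su.1.2) (fun su => su.2) }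
    = sSup { e | ∃ q : Xr × Xh → Xhat → ℝ,
        IsKernel q ∧
        expect (jointU0 p q) (fun su => d su.1.1 su.2) ≤ D ∧
        e = condH (jointU0 p q) (fun su => su.1.2) (fun su => su.2) } := by
  refine csSup_eq_csSup_of_forall_exists_le ?_ ?_
  · rintro _ ⟨U, _, pu, g, hpu, hdist, rfl⟩
    refine ⟨_, ⟨fun x => pushf (pu x) g, hpu.pushf g, ?_, rfl⟩, ?_⟩
    · rw [jointU0_pushf, expect, sum_pushf_mul]
      exact hdist
    · rw [jointU0_pushf, condH_pushf]
      exact condH_le_condH_comp (fun su => mul_nonneg (hp.1 _) ((hpu _).1 _)) _ _ g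
  · rintro e ⟨q, hq, hdist, he⟩
    exact ⟨e, ⟨Xhat, inferInstance, q, id, hq, hdist, he⟩, le_rfl⟩
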